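/- Let m ≥ 1, N > 2m, let Ψ satisfy condition (K), and let p, q > 0 with either p ≥ 1 or p + q ≥ 2. Assume moreover ∫_{|y|>1} |y|^{−p(N−2m)} Ψ(|y|) dy = ∞. If u ∈ C^{2m}(ℝ^N) is a non-negative solution of (−Δ)^m u ≥ (Ψ(|·|) * u^p) u^q in ℝ^N, then u ≡ 0. -/

import Mathlib

open MeasureTheory Filter Metric

/-- The Laplacian of `u : ℝ^N → ℝ`, defined via the second iterated Fréchet derivative. -/
noncomputable def lap {N : ℕ} (u : EuclideanSpace ℝ (Fin N) → ℝ) :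
    EuclideanSpace ℝ (Fin N) → ℝ :=
  fun x => ∑ i : Fin N,
    iteratedFDeriv ℝ 2 u x ![EuclideanSpace.single i 1, EuclideanSpace.single i 1]

/-- `negLapPow m u = (-Δ)^m u`, the `m`-fold iterate of the negative Laplacian. -/
noncomputable def negLapPow {N : ℕ} (m : ℕ) (u : EuclideanSpace ℝ (Fin N) → ℝ) :
    EuclideanSpace ℝ (Fin N) → ℝ :=
  (fun v => fun x => -(lap v x))^[m] u

/-- Condition (K) on the kernel `Ψ`. -/
structure CondK (N : ℕ) (Ψ : ℝ → ℝ) : Prop where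
  pos : ∀ r : ℝ, 0 < r → 0 < Ψ r
  cont : ContinuousOn (fun x : EuclideanSpace ℝ (Fin N) => Ψ ‖x‖)
    {(0 : EuclideanSpace ℝ (Fin N))}ᶜ
  locInt : LocallyIntegrable (fun x : EuclideanSpace ℝ (Fin N) => Ψ ‖x‖) volume
  anti : AntitoneOn Ψ (Set.Ioi (0 : ℝ))
  tendsto : Tendsto (fun r : ℝ => r ^ N * Ψ r) atTop atTop

open scoped ContDiff Topology

section Laplacian

variable {N : ℕ}

local notation "E" => EuclideanSpace ℝ (Fin N)

lemma two_le_infty : (2 : ℕ∞ω) ≤ ∞ :=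
  WithTop.coe_le_coe.2 (le_top : (2 : ℕ∞) ≤ ⊤)

lemma lap_eq_laplacian (u : E → ℝ) : lap u = Laplacian.laplacian u := by
  rw [InnerProductSpace.laplacian_eq_iteratedFDeriv_orthonormalBasis u
    (EuclideanSpace.basisFun (Fin N) ℝ)]
  funext x
  simp [lap]

lemma lap_eq_sum_fderiv {u : E → ℝ} {x : E} (hu : ContDiffAt ℝ 2 u x) :
    lap u x = ∑ i : Fin N, fderiv ℝ (fun z => fderiv ℝ u z (EuclideanSpace.single i 1)) x
      (EuclideanSpace.single i 1) := by
  have hd : DifferentiableAt ℝ (fderiv ℝ u) x :=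
    (hu.fderiv_right (m := 1) (by norm_num)).differentiableAt (by norm_num)
  refine Finset.sum_congr rfl fun i _ => ?_
  rw [iteratedFDeriv_two_apply, fderiv_clm_apply hd (by fun_prop)]
  simp

lemma contDiff_lap {n : ℕ∞ω} {u : E → ℝ} (hu : ContDiff ℝ (n + 2) u) :
    ContDiff ℝ n (lap u) := by
  refine ContDiff.sum fun i _ => ?_
  have h1 : ContDiff ℝ n (iteratedFDeriv ℝ 2 u) := hu.iteratedFDeriv_right (by norm_num)
  exact (ContinuousMultilinearMap.apply ℝ (fun _ : Fin 2 => E) ℝ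
    ![EuclideanSpace.single i 1, EuclideanSpace.single i 1]).contDiff.comp h1

lemma negLapPow_succ (m : ℕ) (u : E → ℝ) :
    negLapPow (m + 1) u = negLapPow m (fun x => -(lap u x)) := rfl

lemma negLapPow_succ' (m : ℕ) (u : E → ℝ) :
    negLapPow (m + 1) u = fun x => -(lap (negLapPow m u) x) :=
  Function.iterate_succ_apply' _ _ _

lemma continuous_negLapPow (m : ℕ) {u : E → ℝ} (hu : ContDiff ℝ (2 * m) u) :
    Continuous (negLapPow m u) := by
  induction m generalizing u with
  | zero => exact hu.continuous
  | succ m ih =>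
    refine ih (contDiff_lap ?_).neg
    convert hu using 1
    push_cast
    ring

lemma contDiff_negLapPow (m : ℕ) {u : E → ℝ} (hu : ContDiff ℝ ∞ u) :
    ContDiff ℝ ∞ (negLapPow m u) := by
  induction m generalizing u with
  | zero => exact hu
  | succ m ih => exact ih (contDiff_lap hu).neg

lemma negLapPow_eqOn (m : ℕ) {u v : E → ℝ} {U : Set E} (hU : IsOpen U) (h : Set.EqOn u v U) :
    Set.EqOn (negLapPow m u) (negLapPow m v) U := by
  induction m generalizing u v with
  | zero => exact h
  | succ m ih =>
    refine ih fun x hx => ?_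
    have h1 : u =ᶠ[𝓝 x] v := h.eventuallyEq_of_mem (hU.mem_nhds hx)
    simp only [lap, (h1.iteratedFDeriv ℝ 2).eq_of_nhds]

lemma negLapPow_zero_fun (m : ℕ) : negLapPow m (fun _ : E => (0 : ℝ)) = fun _ => 0 := by
  induction m with
  | zero => rfl
  | succ m ih =>
    rw [negLapPow_succ', ih]
    funext x
    simp [lap_eq_laplacian, InnerProductSpace.laplacian_const]

lemma negLapPow_eq_zero (m : ℕ) {u : E → ℝ} {U : Set E} (hU : IsOpen U)
    (h : ∀ x ∈ U, u x = 0) {x : E} (hx : x ∈ U) : negLapPow m u x = 0 := by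
  rw [negLapPow_eqOn m hU (v := fun _ => 0) h hx, negLapPow_zero_fun]

lemma HasCompactSupport.negLapPow (m : ℕ) {u : E → ℝ} (hu : HasCompactSupport u) :
    HasCompactSupport (negLapPow m u) := by
  refine HasCompactSupport.of_support_subset_isCompact hu fun x hx => ?_
  by_contra h
  exact hx (negLapPow_eq_zero m (isClosed_tsupport u).isOpen_compl
    (fun y hy => image_eq_zero_of_notMem_tsupport hy) h)

lemma negLapPow_sub (m : ℕ) {u v : E → ℝ} (hu : ContDiff ℝ ∞ u) (hv : ContDiff ℝ ∞ v) :
    negLapPow m (fun x => u x - v x) = fun x => negLapPow m u x - negLapPow m v x := by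
  induction m with
  | zero => rfl
  | succ m ih =>
    funext x
    simp only [negLapPow_succ', ih, lap_eq_laplacian]
    have h := ((contDiff_negLapPow m hu).contDiffAt.of_le two_le_infty).laplacian_sub
      (x := x) ((contDiff_negLapPow m hv).contDiffAt.of_le two_le_infty)
    change -(Laplacian.laplacian (negLapPow m u - negLapPow m v) x) = _
    rw [h]
    ring

lemma negLapPow_const_mul (m : ℕ) (c : ℝ) {u : E → ℝ} (hu : ContDiff ℝ ∞ u) :
    negLapPow m (fun x => c * u x) = fun x => c * negLapPow m u x := by
  induction m with
  | zero => rfl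
  | succ m ih =>
    funext x
    simp only [negLapPow_succ', ih, lap_eq_laplacian]
    have h := InnerProductSpace.laplacian_smul (x := x) c
      ((contDiff_negLapPow m hu).contDiffAt.of_le two_le_infty)
    change -(Laplacian.laplacian (c • negLapPow m u) x) = _
    rw [h, smul_eq_mul]
    ring

lemma fderiv_comp_dilation (g : E → ℝ) (c : ℝ) (x y : E) :
    fderiv ℝ (fun z => g (c • (z - x))) y = c • fderiv ℝ g (c • (y - x)) := by
  rw [fderiv_comp_sub (f := fun z => g (c • z)) x, fderiv_comp_smul]

lemma lap_comp_dilation {g : E → ℝ} (hg : ContDiff ℝ ∞ g) (c : ℝ) (x y : E) :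
    lap (fun z => g (c • (z - x))) y = c ^ 2 * lap g (c • (y - x)) := by
  have hg2 : ContDiff ℝ 2 g := hg.of_le two_le_infty
  rw [lap_eq_sum_fderiv hg2.contDiffAt, lap_eq_sum_fderiv (by fun_prop), Finset.mul_sum]
  refine Finset.sum_congr rfl fun i _ => ?_
  simp only [fderiv_comp_dilation, smul_apply]
  have hd : DifferentiableAt ℝ (fun z : E => fderiv ℝ g (c • (z - x))
      (EuclideanSpace.single i 1)) y := by
    have : ContDiff ℝ 1 (fderiv ℝ g) := hg2.fderiv_right (by norm_num)
    have h2 := this.differentiable (by norm_num)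
    fun_prop
  rw [fderiv_fun_const_smul hd]
  rw [smul_apply,
    fderiv_comp_dilation (fun z => fderiv ℝ g z (EuclideanSpace.single i 1)) c x y]
  simp only [smul_apply, smul_eq_mul]
  ring

lemma negLapPow_comp_dilation (m : ℕ) {g : E → ℝ} (hg : ContDiff ℝ ∞ g) (c : ℝ) (x : E) :
    negLapPow m (fun z => g (c • (z - x))) =
      fun y => c ^ (2 * m) * negLapPow m g (c • (y - x)) := by
  induction m with
  | zero => funext y; simp [negLapPow]
  | succ m ih =>
    funext y
    have hm := contDiff_negLapPow m hg
    have hm' : ContDiff ℝ ∞ (fun y : E => negLapPow m g (c • (y - x))) := by fun_prop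
    rw [negLapPow_succ', ih, negLapPow_succ']
    have h := congrFun (negLapPow_const_mul 1 (c ^ (2 * m)) hm') y
    change -(lap (fun y => c ^ (2 * m) * negLapPow m g (c • (y - x))) y) =
      c ^ (2 * m) * -(lap (fun y => negLapPow m g (c • (y - x))) y) at h
    simp only
    rw [h, lap_comp_dilation hm]
    ring

lemma integral_lap_mul {v φ : E → ℝ} (hv : ContDiff ℝ 2 v) (hφ : ContDiff ℝ ∞ φ)
    (hs : HasCompactSupport φ) : ∫ x, lap v x * φ x = ∫ x, v x * lap φ x := by
  have hφ2 : ContDiff ℝ 2 φ := hφ.of_le two_le_infty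
  have key : ∀ i : Fin N,
      Integrable (fun x => fderiv ℝ (fun z => fderiv ℝ v z (EuclideanSpace.single i 1)) x
        (EuclideanSpace.single i 1) * φ x) ∧
      Integrable (fun x => v x * fderiv ℝ (fun z => fderiv ℝ φ z (EuclideanSpace.single i 1)) x
        (EuclideanSpace.single i 1)) ∧
      ∫ x, fderiv ℝ (fun z => fderiv ℝ v z (EuclideanSpace.single i 1)) x
        (EuclideanSpace.single i 1) * φ x =
      ∫ x, v x * fderiv ℝ (fun z => fderiv ℝ φ z (EuclideanSpace.single i 1)) x
        (EuclideanSpace.single i 1) := by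
    intro i
    set e : E := EuclideanSpace.single i 1
    have v1 : ContDiff ℝ 1 (fun z => fderiv ℝ v z e) :=
      (hv.fderiv_right (m := 1) (by norm_num)).clm_apply contDiff_const
    have φ1 : ContDiff ℝ 1 (fun z => fderiv ℝ φ z e) :=
      (hφ2.fderiv_right (m := 1) (by norm_num)).clm_apply contDiff_const
    have v2 : Continuous (fun z => fderiv ℝ (fun z => fderiv ℝ v z e) z e) :=
      (v1.continuous_fderiv (by norm_num)).clm_apply continuous_const
    have φ2 : Continuous (fun z => fderiv ℝ (fun z => fderiv ℝ φ z e) z e) :=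
      (φ1.continuous_fderiv (by norm_num)).clm_apply continuous_const
    have s1 : HasCompactSupport (fun z => fderiv ℝ φ z e) := hs.fderiv_apply (𝕜 := ℝ) e
    have s2 : HasCompactSupport (fun z => fderiv ℝ (fun z => fderiv ℝ φ z e) z e) :=
      s1.fderiv_apply (𝕜 := ℝ) e
    have i1 : Integrable (fun x => fderiv ℝ (fun z => fderiv ℝ v z e) x e * φ x) :=
      (v2.mul hφ.continuous).integrable_of_hasCompactSupport hs.mul_left
    have i2 : Integrable (fun x => fderiv ℝ v x e * fderiv ℝ φ x e) :=
      (v1.continuous.mul φ1.continuous).integrable_of_hasCompactSupport s1.mul_left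
    have i3 : Integrable (fun x => v x * fderiv ℝ (fun z => fderiv ℝ φ z e) x e) :=
      (hv.continuous.mul φ2).integrable_of_hasCompactSupport s2.mul_left
    have i4 : Integrable (fun x => fderiv ℝ v x e * φ x) :=
      (v1.continuous.mul hφ.continuous).integrable_of_hasCompactSupport hs.mul_left
    have i5 : Integrable (fun x => v x * fderiv ℝ φ x e) :=
      (hv.continuous.mul φ1.continuous).integrable_of_hasCompactSupport s1.mul_left
    refine ⟨i1, i3, ?_⟩
    have a1 := integral_mul_fderiv_eq_neg_fderiv_mul_of_integrable (v := e) i1 i2 i4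
      (fun x _ => v1.differentiable (by norm_num) x) (fun x _ => hφ2.differentiable (by norm_num) x)
    have a2 := integral_mul_fderiv_eq_neg_fderiv_mul_of_integrable (v := e) i2 i3 i5
      (fun x _ => hv.differentiable (by norm_num) x) (fun x _ => φ1.differentiable (by norm_num) x)
    linarith
  simp only [lap_eq_sum_fderiv hv.contDiffAt, lap_eq_sum_fderiv hφ2.contDiffAt, Finset.sum_mul,
    Finset.mul_sum]
  rw [integral_finsetSum _ fun i _ => (key i).1, integral_finsetSum _ fun i _ => (key i).2.1]
  exact Finset.sum_congr rfl fun i _ => (key i).2.2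

lemma integral_negLapPow_mul (m : ℕ) {v φ : E → ℝ} (hv : ContDiff ℝ (2 * m) v)
    (hφ : ContDiff ℝ ∞ φ) (hs : HasCompactSupport φ) :
    ∫ x, negLapPow m v x * φ x = ∫ x, v x * negLapPow m φ x := by
  induction m generalizing v with
  | zero => rfl
  | succ m ih =>
    have hv' : ContDiff ℝ (2 * m + 2) v := by
      convert hv using 1
      push_cast
      ring
    rw [negLapPow_succ, ih (contDiff_lap hv').neg, negLapPow_succ']
    simp only [neg_mul, mul_neg, integral_neg]
    rw [integral_lap_mul (hv'.of_le le_add_self) (contDiff_negLapPow m hφ) (hs.negLapPow m)]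

end Laplacian

section RadialKernel

variable {N : ℕ}

local notation "E" => EuclideanSpace ℝ (Fin N)

lemma hasFDerivAt_normSq_rpow (b : ℝ) {x : E} (hx : x ≠ 0) :
    HasFDerivAt (fun y : E => (‖y‖ ^ 2) ^ (-b))
      ((-b * (‖x‖ ^ 2) ^ (-b - 1)) • ((2 : ℕ) • innerSL ℝ x)) x :=
  ((hasStrictFDerivAt_norm_sq x).hasFDerivAt).rpow_const (p := -b) (Or.inl (by positivity))

lemma lap_normSq_rpow (c b : ℝ) {x : E} (hx : x ≠ 0) :
    lap (fun y : E => c * (‖y‖ ^ 2) ^ (-b)) x =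
      c * (2 * b * (2 * b + 2 - N)) * (‖x‖ ^ 2) ^ (-(b + 1)) := by
  have hx2 : 0 < ‖x‖ ^ 2 := by positivity
  have hsm : ContDiffAt ℝ 2 (fun y : E => c * (‖y‖ ^ 2) ^ (-b)) x :=
    contDiffAt_const.mul ((contDiff_norm_sq ℝ).contDiffAt.rpow_const_of_ne hx2.ne')
  have hpart : ∀ i : Fin N,
      fderiv ℝ (fun z => fderiv ℝ (fun y : E => c * (‖y‖ ^ 2) ^ (-b)) z
        (EuclideanSpace.single i 1)) x (EuclideanSpace.single i 1) =
      c * (-2 * b) * (‖x‖ ^ 2) ^ (-(b + 1)) +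
        c * (4 * b * (b + 1)) * (‖x‖ ^ 2) ^ (-(b + 2)) * (x i) ^ 2 := by
    intro i
    have h1 : (fun z => fderiv ℝ (fun y : E => c * (‖y‖ ^ 2) ^ (-b)) z
        (EuclideanSpace.single i 1)) =ᶠ[𝓝 x]
        fun z : E => (c * (-2 * b)) * ((‖z‖ ^ 2) ^ (-(b + 1)) * z i) := by
      filter_upwards [isOpen_ne.mem_nhds hx] with z hz
      rw [((hasFDerivAt_normSq_rpow b hz).const_mul c).fderiv]
      simp only [smul_apply, smul_eq_mul, innerSL_apply_apply,
        EuclideanSpace.inner_single_right]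
      simp
      ring_nf
    have hcoord : HasFDerivAt (fun z : E => z i) (EuclideanSpace.proj i : E →L[ℝ] ℝ) x :=
      (EuclideanSpace.proj (𝕜 := ℝ) i).hasFDerivAt
    rw [h1.fderiv_eq, (((hasFDerivAt_normSq_rpow (b + 1) hx).fun_mul hcoord).const_mul _).fderiv]
    simp only [smul_apply, add_apply, smul_eq_mul, innerSL_apply_apply,
      EuclideanSpace.inner_single_right]
    simp
    ring_nf
  rw [lap_eq_sum_fderiv hsm, Finset.sum_congr rfl fun i _ => hpart i, Finset.sum_add_distrib,
    ← Finset.mul_sum _ (fun i => (x i) ^ 2)]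
  have hn : ∑ i : Fin N, (x i) ^ 2 = ‖x‖ ^ 2 := by
    rw [EuclideanSpace.norm_sq_eq]
    simp
  have hp : (‖x‖ ^ 2) ^ (-(b + 2)) * ‖x‖ ^ 2 = (‖x‖ ^ 2) ^ (-(b + 1)) := by
    rw [← Real.rpow_add_one hx2.ne']
    ring_nf
  rw [hn, mul_assoc _ _ (‖x‖ ^ 2), hp]
  simp
  ring

lemma negLapPow_normSq_rpow_eq_zero {m : ℕ} (hm : 1 ≤ m) (c b : ℝ) (hb : 2 * b = N - 2 * m)
    {x : E} (hx : x ≠ 0) : negLapPow m (fun y : E => c * (‖y‖ ^ 2) ^ (-b)) x = 0 := by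
  induction m, hm using Nat.le_induction generalizing c b with
  | base =>
    change -(lap (fun y : E => c * (‖y‖ ^ 2) ^ (-b)) x) = 0
    rw [lap_normSq_rpow c b hx, hb]
    push_cast
    ring
  | succ m hm ih =>
    have h := negLapPow_eqOn m (isOpen_ne (x := (0 : E)))
      (u := fun y => -(lap (fun y : E => c * (‖y‖ ^ 2) ^ (-b)) y))
      (v := fun y => (-(c * (2 * b * (2 * b + 2 - N)))) * (‖y‖ ^ 2) ^ (-(b + 1)))
      (fun y hy => by simp only; rw [lap_normSq_rpow c b hy]; ring)
    rw [negLapPow_succ, h hx]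
    refine ih _ _ ?_
    push_cast at hb
    linarith

/-- The kernel `|y|^(-2b)`, smoothly cut off near the origin. -/
noncomputable def truncKernel (b : ℝ) (y : E) : ℝ :=
  Real.smoothTransition (2 * ‖y‖ ^ 2 - 1) * (‖y‖ ^ 2) ^ (-b)

lemma contDiff_truncKernel (b : ℝ) : ContDiff ℝ ∞ (truncKernel b : E → ℝ) := by
  rw [contDiff_iff_contDiffAt]
  intro x
  by_cases hx : x = 0
  · have h : (truncKernel b : E → ℝ) =ᶠ[𝓝 x] fun _ => 0 := by
      filter_upwards [ball_mem_nhds x (by norm_num : (0 : ℝ) < 1 / 2)] with y hy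
      rw [hx, mem_ball_zero_iff] at hy
      rw [truncKernel, Real.smoothTransition.zero_of_nonpos, zero_mul]
      nlinarith [norm_nonneg y]
    exact contDiffAt_const.congr_of_eventuallyEq h
  · have hx2 : ‖x‖ ^ 2 ≠ 0 := by positivity
    have hn : ContDiffAt ℝ ∞ (fun y : E => ‖y‖ ^ 2) x := (contDiff_norm_sq ℝ).contDiffAt
    exact (Real.smoothTransition.contDiffAt.comp x
      ((contDiffAt_const.mul hn).sub contDiffAt_const)).mul (hn.rpow_const_of_ne hx2)

lemma negLapPow_truncKernel {m : ℕ} (hm : 1 ≤ m) (b : ℝ) (hb : 2 * b = N - 2 * m)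
    {x : E} (hx : 1 < ‖x‖) : negLapPow m (truncKernel b) x = 0 := by
  have hU : IsOpen {y : E | 1 < ‖y‖} := isOpen_lt continuous_const continuous_norm
  rw [negLapPow_eqOn m hU (v := fun y : E => 1 * (‖y‖ ^ 2) ^ (-b)) ?_ hx]
  · refine negLapPow_normSq_rpow_eq_zero hm 1 b hb ?_
    rintro rfl
    norm_num at hx
  · intro y hy
    simp only [Set.mem_ofPred_eq] at hy
    rw [truncKernel, Real.smoothTransition.one_of_one_le]
    nlinarith

lemma truncKernel_dilation {k : ℕ} {b : ℝ} (hb : 2 * b = k) {c : ℝ} (hc : 0 < c) (z : E) :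
    c ^ k * truncKernel b (c • z) =
      Real.smoothTransition (2 * c ^ 2 * ‖z‖ ^ 2 - 1) * (‖z‖ ^ 2) ^ (-b) := by
  have h1 : ‖c • z‖ ^ 2 = c ^ 2 * ‖z‖ ^ 2 := by
    rw [norm_smul, mul_pow, Real.norm_eq_abs, sq_abs]
  have h2 : c ^ k * (c ^ 2) ^ (-b) = 1 := by
    rw [← Real.rpow_natCast c k, ← Real.rpow_natCast c 2, ← Real.rpow_mul hc.le,
      ← Real.rpow_add hc, ← hb]
    push_cast
    ring_nf
    simp
  rw [truncKernel, h1, Real.mul_rpow (by positivity) (by positivity)]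
  calc _ = (c ^ k * (c ^ 2) ^ (-b)) *
        (Real.smoothTransition (2 * (c ^ 2 * ‖z‖ ^ 2) - 1) * (‖z‖ ^ 2) ^ (-b)) := by ring
    _ = _ := by rw [h2, one_mul, mul_assoc]

/-- The difference of two rescalings of the truncated kernel, a compactly supported function. -/
noncomputable def annularKernel (b : ℝ) (k : ℕ) (c d : ℝ) (x y : E) : ℝ :=
  c ^ k * truncKernel b (c • (y - x)) - d ^ k * truncKernel b (d • (y - x))

lemma annularKernel_eq {k : ℕ} {b : ℝ} (hb : 2 * b = k) {c d : ℝ} (hd : 0 < d) (hc : 0 < c)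
    (x y : E) : annularKernel b k c d x y =
      (Real.smoothTransition (2 * c ^ 2 * ‖y - x‖ ^ 2 - 1) -
        Real.smoothTransition (2 * d ^ 2 * ‖y - x‖ ^ 2 - 1)) * (‖y - x‖ ^ 2) ^ (-b) := by
  rw [annularKernel, truncKernel_dilation hb hc, truncKernel_dilation hb hd]
  ring

lemma annularKernel_nonneg {k : ℕ} {b : ℝ} (hb : 2 * b = k) {c d : ℝ} (hd : 0 < d) (hdc : d ≤ c)
    (x y : E) : 0 ≤ annularKernel b k c d x y := by
  rw [annularKernel_eq hb hd (hd.trans_le hdc)]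
  refine mul_nonneg (sub_nonneg.2 (Real.smoothTransition.monotone ?_)) (by positivity)
  gcongr

lemma annularKernel_eq_rpow {k : ℕ} {b : ℝ} (hb : 2 * b = k) {c d : ℝ} (hd : 0 < d) (hc : 1 ≤ c)
    {x y : E} (h1 : 1 ≤ ‖y - x‖) (h2 : 2 * d ^ 2 * ‖y - x‖ ^ 2 ≤ 1) :
    annularKernel b k c d x y = (‖y - x‖ ^ 2) ^ (-b) := by
  rw [annularKernel_eq hb hd (zero_lt_one.trans_le hc), Real.smoothTransition.one_of_one_le,
    Real.smoothTransition.zero_of_nonpos, sub_zero, one_mul]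
  · linarith
  · nlinarith [mul_le_mul (one_le_pow₀ hc : 1 ≤ c ^ 2) (one_le_pow₀ h1 : 1 ≤ ‖y - x‖ ^ 2)
      zero_le_one (by positivity)]

lemma contDiff_annularKernel (b : ℝ) (k : ℕ) (c d : ℝ) (x : E) :
    ContDiff ℝ ∞ (annularKernel b k c d x) := by
  have h := contDiff_truncKernel (N := N) b
  unfold annularKernel
  fun_prop

lemma hasCompactSupport_annularKernel {k : ℕ} {b : ℝ} (hb : 2 * b = k) {c d : ℝ} (hd : 0 < d)
    (hdc : d ≤ c) (x : E) : HasCompactSupport (annularKernel b k c d x) := by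
  refine HasCompactSupport.of_support_subset_isCompact (isCompact_closedBall x d⁻¹) fun y hy => ?_
  rw [mem_closedBall, dist_eq_norm]
  by_contra! h
  refine hy ?_
  have h1 : 1 ≤ d ^ 2 * ‖y - x‖ ^ 2 := by
    rw [← mul_pow]
    refine one_le_pow₀ ?_
    rw [inv_lt_iff_one_lt_mul₀' hd] at h
    exact h.le
  have h2 : d ^ 2 * ‖y - x‖ ^ 2 ≤ c ^ 2 * ‖y - x‖ ^ 2 := by gcongr
  rw [annularKernel_eq hb hd (hd.trans_le hdc), Real.smoothTransition.one_of_one_le (by linarith),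
    Real.smoothTransition.one_of_one_le (by linarith), sub_self, zero_mul]

lemma negLapPow_annularKernel {m k : ℕ} (hk : k + 2 * m = N) (b : ℝ) (c d : ℝ) (x : E) :
    negLapPow m (annularKernel b k c d x) = fun y =>
      c ^ N * negLapPow m (truncKernel b) (c • (y - x)) -
        d ^ N * negLapPow m (truncKernel b) (d • (y - x)) := by
  have h := contDiff_truncKernel (N := N) b
  have hg : ∀ c : ℝ, ContDiff ℝ ∞ (fun y : E => truncKernel b (c • (y - x))) := by
    intro c
    fun_prop
  change negLapPow m (fun y => c ^ k * truncKernel b (c • (y - x)) -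
    d ^ k * truncKernel b (d • (y - x))) = _
  rw [negLapPow_sub m (contDiff_const.mul (hg c)) (contDiff_const.mul (hg d)),
    negLapPow_const_mul m _ (hg c), negLapPow_const_mul m _ (hg d),
    negLapPow_comp_dilation m h, negLapPow_comp_dilation m h]
  funext y
  simp only [← mul_assoc, ← pow_add, hk]

end RadialKernel

section LowerBound

variable {N : ℕ}

local notation "E" => EuclideanSpace ℝ (Fin N)

lemma norm_sub_le_inv_of_dilation_ne_zero {K : E → ℝ} (hK : ∀ z, 1 < ‖z‖ → K z = 0) {c : ℝ}
    (hc : 0 < c) {x y : E} (h : K (c • (y - x)) ≠ 0) : ‖y - x‖ ≤ c⁻¹ := by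
  by_contra! h1
  refine h (hK _ ?_)
  rw [norm_smul, Real.norm_of_nonneg hc.le]
  rwa [inv_lt_iff_one_lt_mul₀' hc] at h1

lemma hasCompactSupport_dilation {K : E → ℝ} (hK : ∀ z, 1 < ‖z‖ → K z = 0) {c : ℝ}
    (hc : 0 < c) (x : E) : HasCompactSupport (fun y => K (c • (y - x))) :=
  HasCompactSupport.of_support_subset_isCompact (isCompact_closedBall x c⁻¹) fun y hy => by
    rw [mem_closedBall, dist_eq_norm]
    exact norm_sub_le_inv_of_dilation_ne_zero hK hc hy

lemma integral_mul_dilation_le {K u : E → ℝ} (hKc : Continuous K)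
    (hK : ∀ z, 1 < ‖z‖ → K z = 0) (hu : Continuous u) (hpos : ∀ x, 0 ≤ u x) (x : E) {η : ℝ}
    (hη : 0 < η) :
    ∃ c : ℝ, 1 ≤ c ∧ ∫ y, u y * (c ^ N * K (c • (y - x))) ≤ (u x + η) * ∫ z, |K z| := by
  obtain ⟨r, hr, hru⟩ := Metric.continuousAt_iff.1 (hu.continuousAt (x := x)) η hη
  have hc1 : 1 ≤ r⁻¹ + 1 := by linarith [inv_pos.2 hr]
  have hc0 : 0 < r⁻¹ + 1 := by linarith
  refine ⟨r⁻¹ + 1, hc1, ?_⟩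
  set c := r⁻¹ + 1
  have hs := hasCompactSupport_dilation hK hc0 x
  have hKd : Continuous (fun y => K (c • (y - x))) := by fun_prop
  have heq : ∫ y, (u x + η) * (c ^ N * |K (c • (y - x))|) = (u x + η) * ∫ z, |K z| := by
    rw [integral_const_mul, integral_const_mul,
      integral_sub_right_eq_self (fun y => |K (c • y)|) x,
      Measure.integral_comp_smul volume (fun z => |K z|) c, finrank_euclideanSpace_fin, smul_eq_mul,
      abs_of_pos (by positivity), mul_inv_cancel_left₀ (by positivity)]
  rw [← heq]
  refine integral_mono ?_ ?_ fun y => ?_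
  · exact (hu.mul (continuous_const.mul hKd)).integrable_of_hasCompactSupport
      (hs.mul_left.mul_left)
  · exact (continuous_const.mul (continuous_const.mul hKd.abs)).integrable_of_hasCompactSupport
      ((hs.comp_left abs_zero).mul_left.mul_left)
  · by_cases h : K (c • (y - x)) = 0
    · simp [h]
    · have h1 : u y ≤ u x + η := by
        have h2 := norm_sub_le_inv_of_dilation_ne_zero hK hc0 h
        have h3 : dist y x < r := by
          rw [dist_eq_norm]
          refine h2.trans_lt ?_
          rw [inv_lt_comm₀ hc0 hr]
          linarith
        have h4 := hru h3
        rw [Real.dist_eq] at h4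
        linarith [(abs_lt.1 h4).2]
      calc u y * (c ^ N * K (c • (y - x))) ≤ u y * (c ^ N * |K (c • (y - x))|) := by
            have := hpos y
            gcongr
            exact le_abs_self _
        _ ≤ _ := by gcongr

lemma tendsto_integral_mul_dilation {K u : E → ℝ} (hKc : Continuous K)
    (hK : ∀ z, 1 < ‖z‖ → K z = 0) (hu : Continuous u) (hpos : ∀ x, 0 ≤ u x)
    (hmean : Tendsto (fun R : ℝ => (R ^ N)⁻¹ * ∫ y in closedBall (0 : E) R, u y) atTop (𝓝 0))
    (x : E) :
    Tendsto (fun d : ℝ => ∫ y, u y * (d ^ N * K (d • (y - x)))) (𝓝[>] 0) (𝓝 0) := by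
  obtain ⟨C, hC⟩ : ∃ C, ∀ z, |K z| ≤ C := by
    obtain ⟨C, hC⟩ := (isCompact_closedBall (0 : E) 1).exists_bound_of_continuousOn
      hKc.continuousOn
    refine ⟨max C 0, fun z => ?_⟩
    by_cases hz : ‖z‖ ≤ 1
    · exact (hC z (by simpa using hz)).trans (le_max_left _ _)
    · simp [hK z (not_le.1 hz)]
  have hC0 : 0 ≤ C := (abs_nonneg _).trans (hC 0)
  have hR : Tendsto (fun d : ℝ => d⁻¹ + ‖x‖) (𝓝[>] 0) atTop :=
    tendsto_atTop_add_const_right _ _ tendsto_inv_nhdsGT_zero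
  have hlim := (hmean.comp hR).const_mul (C * 2 ^ N)
  rw [mul_zero] at hlim
  refine squeeze_zero_norm' ?_ hlim
  have hx1 : 0 < (‖x‖ + 1)⁻¹ := by positivity
  filter_upwards [Ioo_mem_nhdsGT hx1] with d hd
  have hd0 : 0 < d := hd.1
  have hdx : d * ‖x‖ ≤ 1 := by
    have h1 : d * (‖x‖ + 1) ≤ 1 := by
      rw [← le_div_iff₀ (by positivity), one_div]
      exact hd.2.le
    linarith
  set R := d⁻¹ + ‖x‖
  have hR0 : 0 < R := by positivity
  have hdR : d * R ≤ 2 := by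
    simp only [R, mul_add, mul_inv_cancel₀ hd0.ne']
    linarith
  have hui : IntegrableOn u (closedBall (0 : E) R) :=
    hu.continuousOn.integrableOn_compact (isCompact_closedBall 0 R)
  have hInn : 0 ≤ ∫ y in closedBall (0 : E) R, u y := integral_nonneg hpos
  calc ‖∫ y, u y * (d ^ N * K (d • (y - x)))‖
      ≤ ∫ y, (closedBall (0 : E) R).indicator (fun y => C * d ^ N * u y) y := by
        refine norm_integral_le_of_norm_le
          ((integrable_indicator_iff measurableSet_closedBall).2 (hui.const_mul _))
          (Eventually.of_forall fun y => ?_)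
        by_cases h : K (d • (y - x)) = 0
        · simp only [h, mul_zero, norm_zero]
          exact Set.indicator_nonneg (fun y _ => by have := hpos y; positivity) y
        · have h2 := norm_sub_le_inv_of_dilation_ne_zero hK hd0 h
          have h3 : y ∈ closedBall (0 : E) R := by
            rw [mem_closedBall_zero_iff]
            calc ‖y‖ = ‖(y - x) + x‖ := by simp
              _ ≤ _ := (norm_add_le _ _).trans (by simp only [R]; linarith)
          rw [Set.indicator_of_mem h3, norm_mul, norm_mul, Real.norm_of_nonneg (hpos y),
            Real.norm_of_nonneg (by positivity : 0 ≤ d ^ N), Real.norm_eq_abs]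
          have := hC (d • (y - x))
          have := hpos y
          calc u y * (d ^ N * |K (d • (y - x))|) ≤ u y * (d ^ N * C) := by gcongr
            _ = _ := by ring
    _ = C * d ^ N * ∫ y in closedBall (0 : E) R, u y := by
        rw [integral_indicator measurableSet_closedBall, integral_const_mul]
    _ = C * (d * R) ^ N * ((R ^ N)⁻¹ * ∫ y in closedBall (0 : E) R, u y) := by
        rw [mul_pow]
        field_simp
    _ ≤ _ := by
        simp only [Function.comp]
        gcongr

/-- A nonnegative function whose means over large balls vanish and with nontrivial `(-Δ)^m u ≥ 0`
decays at most like the fundamental solution of `(-Δ)^m`. -/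
lemma exists_lower_bound {m : ℕ} (hm : 1 ≤ m) (hN : 2 * m < N) {u : E → ℝ}
    (hreg : ContDiff ℝ (2 * m) u) (hpos : ∀ x, 0 ≤ u x) (hf : ∀ x, 0 ≤ negLapPow m u x)
    {x₀ : E} (hx₀ : 0 < negLapPow m u x₀)
    (hmean : Tendsto (fun R : ℝ => (R ^ N)⁻¹ * ∫ y in closedBall (0 : E) R, u y) atTop (𝓝 0)) :
    ∃ c > 0, ∃ R₀ ≥ 1, ∀ x : E, R₀ ≤ ‖x‖ → c * ‖x‖ ^ (-((N : ℝ) - 2 * m)) ≤ u x := by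
  have hu : Continuous u := hreg.continuous
  obtain ⟨k, hk⟩ : ∃ k, k + 2 * m = N := ⟨N - 2 * m, by omega⟩
  have hkN : (k : ℝ) = N - 2 * m := by
    rw [← hk]
    push_cast
    ring
  set b : ℝ := k / 2 with hbdef
  have hb : 2 * b = k := by rw [hbdef]; ring
  have hb0 : 0 ≤ b := by positivity
  set f := negLapPow m u with hfdef
  have hfc : Continuous f := continuous_negLapPow m hreg
  set K : E → ℝ := negLapPow m (truncKernel b) with hKdef
  have hKc : Continuous K := (contDiff_negLapPow m (contDiff_truncKernel b)).continuous
  have hK0 : ∀ z, 1 < ‖z‖ → K z = 0 := fun z hz =>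
    negLapPow_truncKernel hm b (by rw [hb, hkN]) hz
  obtain ⟨ρ, hρ, hball⟩ : ∃ ρ > 0, ∀ y ∈ closedBall x₀ ρ, f x₀ / 2 ≤ f y := by
    have h1 : ∀ᶠ y in 𝓝 x₀, f x₀ / 2 ≤ f y :=
      (hfc.continuousAt.eventually_const_lt (half_lt_self hx₀)).mono fun y hy => hy.le
    obtain ⟨ρ, hρ, h⟩ := Metric.nhds_basis_closedBall.eventually_iff.1 h1
    exact ⟨ρ, hρ, fun y hy => h hy⟩
  set V : ℝ := volume.real (closedBall x₀ ρ) with hV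
  have hV0 : 0 < V := by
    rw [hV, measureReal_def]
    exact ENNReal.toReal_pos (measure_closedBall_pos volume x₀ hρ).ne'
      measure_closedBall_lt_top.ne
  set κ : ℝ := ∫ z, |K z| with hκ
  have hκ0 : 0 ≤ κ := integral_nonneg fun z => abs_nonneg _
  have main : ∀ x : E, 1 + ρ ≤ ‖x - x₀‖ →
      f x₀ / 2 * V * ((‖x - x₀‖ + ρ) ^ 2) ^ (-b) ≤ κ * u x := by
    intro x hx
    set A := f x₀ / 2 * V * ((‖x - x₀‖ + ρ) ^ 2) ^ (-b) with hA
    have step : ∀ η > 0, A ≤ (u x + η) * κ := by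
      intro η hη
      obtain ⟨c, hc1, hc⟩ := integral_mul_dilation_le hKc hK0 hu hpos x hη
      have hlim := (tendsto_integral_mul_dilation hKc hK0 hu hpos hmean x).const_sub
        ((u x + η) * κ)
      rw [sub_zero] at hlim
      refine ge_of_tendsto hlim ?_
      set S := ‖x - x₀‖ + ρ with hS
      have hS0 : 0 < S := by positivity
      have hS1 : 0 < (2 * S)⁻¹ := by positivity
      filter_upwards [Ioo_mem_nhdsGT (lt_min hS1 zero_lt_one)] with d hd
      have hd0 : 0 < d := hd.1
      have hd1 : d ≤ c := (hd.2.le.trans (min_le_right _ _)).trans hc1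
      have hdS : d * S ≤ 1 / 2 := by
        have h1 : d ≤ (2 * S)⁻¹ := hd.2.le.trans (min_le_left _ _)
        calc d * S ≤ (2 * S)⁻¹ * S := by gcongr
          _ = 1 / 2 := by field_simp
      have hcs := hasCompactSupport_annularKernel (N := N) hb hd0 hd1 x
      have hsm := contDiff_annularKernel (N := N) b k c d x
      have hdil : ∀ c : ℝ, 0 < c → Integrable (fun y => u y * (c ^ N * K (c • (y - x)))) := by
        intro c hc
        exact (hu.mul (continuous_const.mul (by fun_prop))).integrable_of_hasCompactSupport
          ((hasCompactSupport_dilation hK0 hc x).mul_left.mul_left)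
      have hrep : ∫ y, f y * annularKernel b k c d x y =
          (∫ y, u y * (c ^ N * K (c • (y - x)))) - ∫ y, u y * (d ^ N * K (d • (y - x))) := by
        rw [hfdef, integral_negLapPow_mul m hreg hsm hcs, negLapPow_annularKernel hk,
          ← integral_sub (hdil c (by linarith)) (hdil d hd0)]
        simp only [mul_sub, hKdef]
      have hint : Integrable (fun y => f y * annularKernel b k c d x y) :=
        (hfc.mul hsm.continuous).integrable_of_hasCompactSupport hcs.mul_left
      have hlow : A ≤ ∫ y, f y * annularKernel b k c d x y := by
        calc A = ∫ y in closedBall x₀ ρ, f x₀ / 2 * (S ^ 2) ^ (-b) := by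
              rw [setIntegral_const, smul_eq_mul, hA]
              ring
          _ ≤ ∫ y in closedBall x₀ ρ, f y * annularKernel b k c d x y := by
              refine setIntegral_mono_on (integrableOn_const measure_closedBall_lt_top.ne)
                hint.integrableOn measurableSet_closedBall fun y hy => ?_
              have h0 : ‖y - x₀‖ ≤ ρ := by rwa [← dist_eq_norm]
              have h1 : 1 ≤ ‖y - x‖ := by
                have := norm_sub_le_norm_sub_add_norm_sub x y x₀
                rw [norm_sub_rev x y] at this
                linarith
              have h2 : ‖y - x‖ ≤ S := by
                have := norm_sub_le_norm_sub_add_norm_sub y x₀ x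
                rw [norm_sub_rev x₀ x] at this
                linarith
              have h3 : d * ‖y - x‖ ≤ 1 / 2 := le_trans (by gcongr) hdS
              rw [annularKernel_eq_rpow hb hd0 hc1 h1 (by
                nlinarith [mul_nonneg hd0.le (norm_nonneg (y - x))])]
              refine mul_le_mul (hball y hy) ?_ (by positivity) (hf y)
              exact Real.rpow_le_rpow_of_nonpos (by positivity) (by gcongr) (by linarith)
          _ ≤ ∫ y, f y * annularKernel b k c d x y :=
              setIntegral_le_integral hint (Eventually.of_forall fun y =>
                mul_nonneg (hf y) (annularKernel_nonneg hb hd0 hd1 x y))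
      rw [hrep] at hlow
      linarith
    have hlim : Tendsto (fun η => (u x + η) * κ) (𝓝[>] 0) (𝓝 ((u x + 0) * κ)) := by
      have : Continuous fun η => (u x + η) * κ := by fun_prop
      exact (this.tendsto 0).mono_left nhdsWithin_le_nhds
    have h := ge_of_tendsto hlim (eventually_mem_nhdsWithin.mono fun η hη => step η hη)
    rw [add_zero] at h
    linarith
  refine ⟨f x₀ / 2 * V * 2 ^ (-(k : ℝ)) / (κ + 1), by positivity, 1 + ρ + ‖x₀‖,
    by linarith [norm_nonneg x₀], fun x hx => ?_⟩
  have h1 : 1 + ρ ≤ ‖x - x₀‖ := by linarith [norm_sub_norm_le x x₀]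
  have h2 : ‖x - x₀‖ + ρ ≤ 2 * ‖x‖ := by linarith [norm_sub_le x x₀]
  have hx0 : 0 < ‖x‖ := by linarith [norm_nonneg x₀]
  have h3 : (2 * ‖x‖) ^ (-(k : ℝ)) ≤ ((‖x - x₀‖ + ρ) ^ 2) ^ (-b) := by
    rw [← Real.rpow_natCast (‖x - x₀‖ + ρ) 2, ← Real.rpow_mul (by positivity)]
    have : ((2 : ℕ) : ℝ) * -b = -(k : ℝ) := by
      rw [← hb]
      push_cast
      ring
    rw [this]
    exact Real.rpow_le_rpow_of_nonpos (by positivity) h2 (by simp)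
  rw [Real.mul_rpow (by norm_num) hx0.le] at h3
  have h4 := main x h1
  rw [← hkN, div_mul_eq_mul_div, div_le_iff₀ (by positivity)]
  calc f x₀ / 2 * V * 2 ^ (-(k : ℝ)) * ‖x‖ ^ (-(k : ℝ))
      = f x₀ / 2 * V * (2 ^ (-(k : ℝ)) * ‖x‖ ^ (-(k : ℝ))) := by ring
    _ ≤ f x₀ / 2 * V * ((‖x - x₀‖ + ρ) ^ 2) ^ (-b) := by gcongr
    _ ≤ κ * u x := h4
    _ ≤ u x * (κ + 1) := by linarith [hpos x]

end LowerBound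

section Cutoff

variable {N : ℕ}

local notation "E" => EuclideanSpace ℝ (Fin N)

lemma exists_fderiv_pow_mul {ψ g : E → ℝ} (hψ : ContDiff ℝ ∞ ψ) (hg : ContDiff ℝ ∞ g) (n : ℕ)
    (e : E) : ∃ g' : E → ℝ, ContDiff ℝ ∞ g' ∧
      ∀ x, fderiv ℝ (fun y => ψ y ^ (n + 1) * g y) x e = ψ x ^ n * g' x := by
  refine ⟨fun x => (n + 1) * fderiv ℝ ψ x e * g x + ψ x * fderiv ℝ g x e, ?_, fun x => ?_⟩
  · have h1 : ContDiff ℝ ∞ (fun x => fderiv ℝ ψ x e) :=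
      (hψ.fderiv_right (m := ∞) le_rfl).clm_apply contDiff_const
    have h2 : ContDiff ℝ ∞ (fun x => fderiv ℝ g x e) :=
      (hg.fderiv_right (m := ∞) le_rfl).clm_apply contDiff_const
    exact ((contDiff_const.mul h1).mul hg).add (hψ.mul h2)
  · have h1 := (hψ.differentiable (by simp) x).hasFDerivAt
    have h2 := (hg.differentiable (by simp) x).hasFDerivAt
    rw [((h1.pow (n + 1)).fun_mul h2).fderiv]
    simp only [add_apply, smul_apply, smul_eq_mul, nsmul_eq_mul, Nat.add_sub_cancel]
    push_cast
    ring

lemma exists_negLapPow_pow_mul {ψ g : E → ℝ} (hψ : ContDiff ℝ ∞ ψ) (hg : ContDiff ℝ ∞ g)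
    (n m : ℕ) : ∃ g' : E → ℝ, ContDiff ℝ ∞ g' ∧
      ∀ x, negLapPow m (fun y => ψ y ^ (n + 2 * m) * g y) x = ψ x ^ n * g' x := by
  induction m generalizing n with
  | zero => exact ⟨g, hg, fun x => rfl⟩
  | succ m ih =>
    obtain ⟨g₁, hg₁, h₁⟩ := ih (n + 2)
    have h₁' : negLapPow m (fun y => ψ y ^ (n + 2 * (m + 1)) * g y) =
        fun x => ψ x ^ (n + 1 + 1) * g₁ x := by
      funext x
      rw [← h₁ x]
      ring_nf
    choose g₂ hg₂ h₂ using fun i : Fin N =>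
      exists_fderiv_pow_mul hψ hg₁ (n + 1) (EuclideanSpace.single i 1)
    choose g₃ hg₃ h₃ using fun i : Fin N =>
      exists_fderiv_pow_mul hψ (hg₂ i) n (EuclideanSpace.single i 1)
    refine ⟨fun x => -∑ i, g₃ i x, (ContDiff.sum fun i _ => hg₃ i).neg, fun x => ?_⟩
    have hc : ContDiff ℝ 2 (fun x => ψ x ^ (n + 1 + 1) * g₁ x) :=
      ((hψ.pow _).mul hg₁).of_le two_le_infty
    rw [negLapPow_succ', h₁']
    simp only
    rw [lap_eq_sum_fderiv hc.contDiffAt]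
    simp only [h₂, h₃, ← Finset.mul_sum, mul_neg]

lemma exists_cutoff (m : ℕ) : ∃ w : E → ℝ, ContDiff ℝ ∞ w ∧ (∀ x, 0 ≤ w x) ∧ (∀ x, w x ≤ 1) ∧
    (∀ x, ‖x‖ ≤ 1 / 2 → w x = 1) ∧ (∀ x, 1 < ‖x‖ → w x = 0) ∧
    ∃ C > 0, ∀ x, negLapPow m (fun y => w y ^ 2) x ≤ C * w x := by
  let ψ : ContDiffBump (0 : E) := ⟨1 / 2, 1, by norm_num, by norm_num⟩
  have hψ : ContDiff ℝ ∞ ψ := ψ.contDiff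
  obtain ⟨g, hg, h⟩ := exists_negLapPow_pow_mul hψ
    (contDiff_const (c := (1 : ℝ))) (2 * (m + 1) + 2) m
  refine ⟨fun x => ψ x ^ (2 * m + 2), hψ.pow _, fun x => pow_nonneg ψ.nonneg _,
    fun x => pow_le_one₀ ψ.nonneg ψ.le_one, fun x hx => ?_, fun x hx => ?_, ?_⟩
  · simp only
    rw [ψ.one_of_mem_closedBall (mem_closedBall_zero_iff.2 hx), one_pow]
  · simp only
    rw [ψ.zero_of_le_dist (by simpa using hx.le), zero_pow (by omega)]
  · obtain ⟨C, hC⟩ := (isCompact_closedBall (0 : E) 1).exists_bound_of_continuousOn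
      hg.continuous.continuousOn
    refine ⟨max C 1, by positivity, fun x => ?_⟩
    have he : (fun y => (ψ y ^ (2 * m + 2)) ^ 2) =
        fun y => ψ y ^ (2 * (m + 1) + 2 + 2 * m) * (1 : ℝ) := by
      funext y
      ring
    rw [he, h x]
    have h0 : 0 ≤ ψ x := ψ.nonneg
    by_cases hx : ‖x‖ ≤ 1
    · have h1 : g x ≤ max C 1 :=
        (le_abs_self _).trans ((hC x (by simpa using hx)).trans (le_max_left _ _))
      have h2 : ψ x ^ (2 * (m + 1) + 2) ≤ ψ x ^ (2 * m + 2) :=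
        pow_le_pow_of_le_one h0 ψ.le_one (by omega)
      calc ψ x ^ (2 * (m + 1) + 2) * g x ≤ ψ x ^ (2 * (m + 1) + 2) * max C 1 := by gcongr
        _ ≤ ψ x ^ (2 * m + 2) * max C 1 := by gcongr
        _ = _ := mul_comm _ _
    · rw [ψ.zero_of_le_dist (by simpa using (not_le.1 hx).le), zero_pow (by omega), zero_mul]
      simp only
      positivity

end Cutoff

section Convolution

variable {N : ℕ} {Ψ : ℝ → ℝ} {p : ℝ} {u : EuclideanSpace ℝ (Fin N) → ℝ}

local notation "E" => EuclideanSpace ℝ (Fin N)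

lemma integrable_rpow_mul_kernel (hK : CondK N Ψ) (hp : 0 < p) (hu : Continuous u)
    (hpos : ∀ x, 0 ≤ u x)
    (hint : IntegrableOn (fun y : E => u y ^ p * Ψ (‖y‖ / 2)) {y : E | 1 < ‖y‖}) (x : E) :
    Integrable (fun y => u y ^ p * Ψ ‖y - x‖) := by
  have hup : Continuous (fun y => u y ^ p) := hu.rpow_const fun _ => Or.inr hp.le
  set M := 2 * ‖x‖ + 1 with hM
  have hnear : IntegrableOn (fun y => u y ^ p * Ψ ‖y - x‖) (closedBall 0 M) := by
    refine IntegrableOn.continuousOn_mul hup.continuousOn ?_ (isCompact_closedBall 0 M)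
    have h1 : Integrable ((closedBall (0 : E) (M + ‖x‖)).indicator fun y => Ψ ‖y‖) :=
      (integrable_indicator_iff measurableSet_closedBall).2
        (hK.locInt.integrableOn_isCompact (isCompact_closedBall _ _))
    refine (h1.comp_sub_right x).integrableOn.congr_fun (fun y hy => ?_) measurableSet_closedBall
    rw [mem_closedBall_zero_iff] at hy
    refine Set.indicator_of_mem ?_ _
    rw [mem_closedBall_zero_iff]
    exact (norm_sub_le _ _).trans (by linarith)
  have hmeas : AEStronglyMeasurable (fun y : E => u y ^ p * Ψ ‖y - x‖) :=
    hup.aestronglyMeasurable.mul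
      (hK.locInt.aestronglyMeasurable.comp_measurePreserving (measurePreserving_sub_right volume x))
  have hfar : IntegrableOn (fun y => u y ^ p * Ψ ‖y - x‖) (closedBall 0 M)ᶜ := by
    have hsub : (closedBall (0 : E) M)ᶜ ⊆ {y : E | 1 < ‖y‖} := by
      intro y hy
      simp only [Set.mem_compl_iff, mem_closedBall_zero_iff, not_le] at hy
      change 1 < ‖y‖
      linarith [norm_nonneg x]
    refine Integrable.mono' (hint.mono_set hsub) hmeas.restrict ?_
    refine (ae_restrict_iff' measurableSet_closedBall.compl).2 (Eventually.of_forall fun y hy => ?_)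
    simp only [Set.mem_compl_iff, mem_closedBall_zero_iff, not_le] at hy
    have hy0 : 0 < ‖y‖ / 2 := by linarith [norm_nonneg x]
    have hle : ‖y‖ / 2 ≤ ‖y - x‖ := by linarith [norm_sub_norm_le y x]
    have hu0 : 0 ≤ u y ^ p := Real.rpow_nonneg (hpos y) p
    rw [Real.norm_of_nonneg (mul_nonneg hu0 (hK.pos _ (hy0.trans_le hle)).le)]
    exact mul_le_mul_of_nonneg_left (hK.anti hy0 (hy0.trans_le hle) hle) hu0
  rw [← integrableOn_univ, ← Set.union_compl_self (closedBall (0 : E) M)]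
  exact hnear.union hfar

lemma kernel_mul_integral_le (hN : 0 < N) (hK : CondK N Ψ) (hp : 0 < p) (hu : Continuous u)
    (hpos : ∀ x, 0 ≤ u x)
    (hint : IntegrableOn (fun y : E => u y ^ p * Ψ (‖y‖ / 2)) {y : E | 1 < ‖y‖}) {x : E} {R : ℝ}
    (hx : ‖x‖ ≤ R) :
    Ψ (2 * R) * ∫ y in closedBall (0 : E) R, u y ^ p ≤ ∫ y, u y ^ p * Ψ ‖y - x‖ := by
  have : Nonempty (Fin N) := ⟨⟨0, hN⟩⟩
  have hup : Continuous (fun y => u y ^ p) := hu.rpow_const fun _ => Or.inr hp.le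
  have hI := integrable_rpow_mul_kernel hK hp hu hpos hint x
  have hne : ∀ᵐ y : E, y ≠ x := compl_mem_ae_iff.2 (measure_singleton x)
  rw [← integral_const_mul]
  refine le_trans (setIntegral_mono_on_ae ?_ hI.integrableOn measurableSet_closedBall ?_)
    (setIntegral_le_integral hI ?_)
  · exact (hup.continuousOn.integrableOn_compact (isCompact_closedBall 0 R)).const_mul _
  · filter_upwards [hne] with y hy hyR
    rw [mem_closedBall_zero_iff] at hyR
    have h0 : 0 < ‖y - x‖ := norm_pos_iff.2 (sub_ne_zero.2 hy)
    have h1 : ‖y - x‖ ≤ 2 * R := (norm_sub_le _ _).trans (by linarith)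
    rw [mul_comm]
    exact mul_le_mul_of_nonneg_left (hK.anti h0 (h0.trans_le h1) h1) (Real.rpow_nonneg (hpos y) p)
  · filter_upwards [hne] with y hy
    exact mul_nonneg (Real.rpow_nonneg (hpos y) p)
      (hK.pos _ (norm_pos_iff.2 (sub_ne_zero.2 hy))).le

lemma tendsto_mean_rpow (hN : 0 < N) (hK : CondK N Ψ) (hp : 0 < p) (hu : Continuous u)
    (hpos : ∀ x, 0 ≤ u x)
    (hint : IntegrableOn (fun y : E => u y ^ p * Ψ (‖y‖ / 2)) {y : E | 1 < ‖y‖}) :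
    Tendsto (fun R : ℝ => (R ^ N)⁻¹ * ∫ y in closedBall (0 : E) R, u y ^ p) atTop (𝓝 0) := by
  have hup : Continuous (fun y => u y ^ p) := hu.rpow_const fun _ => Or.inr hp.le
  have hu0 : ∀ y, 0 ≤ u y ^ p := fun y => Real.rpow_nonneg (hpos y) p
  set C := ∫ y in closedBall (0 : E) 1, u y ^ p
  set I := ∫ y in {y : E | 1 < ‖y‖}, u y ^ p * Ψ (‖y‖ / 2)
  have hlim : Tendsto (fun R : ℝ => (R ^ N)⁻¹ * C + (R ^ N * Ψ R)⁻¹ * I) atTop (𝓝 0) := by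
    have h1 : Tendsto (fun R : ℝ => (R ^ N)⁻¹) atTop (𝓝 0) :=
      (tendsto_pow_atTop hN.ne').inv_tendsto_atTop
    have h2 : Tendsto (fun R : ℝ => (R ^ N * Ψ R)⁻¹) atTop (𝓝 0) := hK.tendsto.inv_tendsto_atTop
    simpa using (h1.mul_const C).add (h2.mul_const I)
  refine squeeze_zero' ?_ ?_ hlim
  · filter_upwards [eventually_ge_atTop 0] with R hR
    have : 0 ≤ ∫ y in closedBall (0 : E) R, u y ^ p := integral_nonneg hu0
    positivity
  · filter_upwards [eventually_ge_atTop 1] with R hR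
    have hR0 : 0 < R := by linarith
    have hΨ := hK.pos R hR0
    have hiR : IntegrableOn (fun y => u y ^ p) (closedBall (0 : E) R) :=
      hup.continuousOn.integrableOn_compact (isCompact_closedBall 0 R)
    have hout : ∀ y ∈ closedBall (0 : E) R \ closedBall 0 1, 1 < ‖y‖ ∧ ‖y‖ ≤ R := by
      rintro y ⟨h1, h2⟩
      simp only [mem_closedBall_zero_iff, not_le] at h1 h2
      exact ⟨h2, h1⟩
    have hsub : closedBall (0 : E) R \ closedBall 0 1 ⊆ {y : E | 1 < ‖y‖} :=
      fun y hy => (hout y hy).1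
    have hmS : MeasurableSet {y : E | 1 < ‖y‖} :=
      (isOpen_lt continuous_const continuous_norm).measurableSet
    have h1 : ∫ y in closedBall (0 : E) R \ closedBall 0 1, u y ^ p ≤ (Ψ R)⁻¹ * I := by
      calc ∫ y in closedBall (0 : E) R \ closedBall 0 1, u y ^ p
          ≤ ∫ y in closedBall (0 : E) R \ closedBall 0 1, (Ψ R)⁻¹ * (u y ^ p * Ψ (‖y‖ / 2)) := by
            refine setIntegral_mono_on (hiR.mono_set Set.sdiff_subset)
              ((hint.mono_set hsub).const_mul _)
              (measurableSet_closedBall.diff measurableSet_closedBall) fun y hy => ?_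
            obtain ⟨hy1, hy2⟩ := hout y hy
            have h2 : Ψ R ≤ Ψ (‖y‖ / 2) := hK.anti (Set.mem_Ioi.2 (by linarith)) hR0 (by linarith)
            rw [inv_mul_eq_div, le_div_iff₀ hΨ]
            exact mul_le_mul_of_nonneg_left h2 (hu0 y)
        _ ≤ ∫ y in {y : E | 1 < ‖y‖}, (Ψ R)⁻¹ * (u y ^ p * Ψ (‖y‖ / 2)) := by
            refine setIntegral_mono_set (hint.const_mul _) ?_ hsub.eventuallyLE
            refine (ae_restrict_iff' hmS).2 (Eventually.of_forall fun y hy => ?_)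
            have hy' : 1 < ‖y‖ := hy
            exact mul_nonneg (inv_nonneg.2 hΨ.le)
              (mul_nonneg (hu0 y) (hK.pos _ (by linarith)).le)
        _ = (Ψ R)⁻¹ * I := integral_const_mul _ _
    have h2 : ∫ y in closedBall (0 : E) R, u y ^ p ≤ C + (Ψ R)⁻¹ * I := by
      rw [← integral_inter_add_sdiff measurableSet_closedBall hiR (t := closedBall (0 : E) 1),
        Set.inter_eq_self_of_subset_right (closedBall_subset_closedBall hR)]
      exact add_le_add le_rfl h1
    calc (R ^ N)⁻¹ * ∫ y in closedBall (0 : E) R, u y ^ p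
        ≤ (R ^ N)⁻¹ * (C + (Ψ R)⁻¹ * I) := by gcongr
      _ = _ := by rw [mul_inv]; ring

lemma tendsto_zero_of_eventually_le_mul {g : ℝ → ℝ} {C : ℝ} (hC : 0 < C)
    (h0 : ∀ᶠ R in atTop, 0 ≤ g R) (h : ∀ δ > 0, ∀ᶠ R in atTop, g R ≤ C * δ) :
    Tendsto g atTop (𝓝 0) := by
  refine tendsto_order.2 ⟨fun a ha => h0.mono fun R hR => ha.trans_le hR, fun a ha => ?_⟩
  filter_upwards [h (a / (2 * C)) (by positivity)] with R hR
  refine hR.trans_lt ?_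
  rw [mul_div_assoc', mul_comm C, mul_div_mul_right _ _ hC.ne']
  linarith

lemma le_add_rpow_mul_rpow {t δ : ℝ} (ht : 0 ≤ t) (hδ : 0 < δ) (hp : 1 ≤ p) :
    t ≤ δ + δ ^ (1 - p) * t ^ p := by
  rcases le_or_gt t δ with h | h
  · have : 0 ≤ δ ^ (1 - p) * t ^ p := by positivity
    linarith
  · have ht0 : 0 < t := hδ.trans h
    have h1 : t ^ (1 - p) ≤ δ ^ (1 - p) := Real.rpow_le_rpow_of_nonpos hδ h.le (by linarith)
    have h2 : t ^ (1 - p) * t ^ p = t := by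
      rw [← Real.rpow_add ht0, sub_add_cancel, Real.rpow_one]
    have h3 : t ^ (1 - p) * t ^ p ≤ δ ^ (1 - p) * t ^ p := by gcongr
    linarith

lemma tendsto_mean_of_one_le (hp : 1 ≤ p) (hu : Continuous u) (hpos : ∀ x, 0 ≤ u x)
    (hmean : Tendsto (fun R : ℝ => (R ^ N)⁻¹ * ∫ y in closedBall (0 : E) R, u y ^ p) atTop
      (𝓝 0)) :
    Tendsto (fun R : ℝ => (R ^ N)⁻¹ * ∫ y in closedBall (0 : E) R, u y) atTop (𝓝 0) := by
  have hup : Continuous (fun y => u y ^ p) := hu.rpow_const fun _ => Or.inr (by linarith)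
  set V := volume.real (ball (0 : E) 1) with hV
  have hV0 : 0 ≤ V := measureReal_nonneg
  refine tendsto_zero_of_eventually_le_mul (C := V + 1) (by positivity) ?_ fun δ hδ => ?_
  · filter_upwards [eventually_ge_atTop 0] with R hR
    have : 0 ≤ ∫ y in closedBall (0 : E) R, u y := integral_nonneg hpos
    positivity
  · have hsm := (hmean.const_mul (δ ^ (1 - p))).eventually_le_const (u := δ) (by simpa using hδ)
    filter_upwards [hsm, eventually_gt_atTop 0] with R hR hR0
    have hvol : volume.real (closedBall (0 : E) R) = R ^ N * V := by
      rw [hV, Measure.addHaar_real_closedBall _ _ hR0.le, finrank_euclideanSpace_fin]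
    have hiR : IntegrableOn (fun y => u y ^ p) (closedBall (0 : E) R) :=
      hup.continuousOn.integrableOn_compact (isCompact_closedBall 0 R)
    have hcst : IntegrableOn (fun _ : E => δ) (closedBall (0 : E) R) :=
      integrableOn_const measure_closedBall_lt_top.ne
    have h1 : ∫ y in closedBall (0 : E) R, u y ≤
        R ^ N * V * δ + δ ^ (1 - p) * ∫ y in closedBall (0 : E) R, u y ^ p := by
      calc ∫ y in closedBall (0 : E) R, u y
          ≤ ∫ y in closedBall (0 : E) R, (δ + δ ^ (1 - p) * u y ^ p) :=
            setIntegral_mono_on (hu.continuousOn.integrableOn_compact (isCompact_closedBall 0 R))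
              (hcst.add (hiR.const_mul _)) measurableSet_closedBall
              fun y _ => le_add_rpow_mul_rpow (hpos y) hδ hp
        _ = _ := by
            rw [integral_add hcst (hiR.const_mul _), setIntegral_const, integral_const_mul, hvol,
              smul_eq_mul]
    calc (R ^ N)⁻¹ * ∫ y in closedBall (0 : E) R, u y
        ≤ (R ^ N)⁻¹ * (R ^ N * V * δ + δ ^ (1 - p) * ∫ y in closedBall (0 : E) R, u y ^ p) := by
          gcongr
      _ = V * δ + δ ^ (1 - p) * ((R ^ N)⁻¹ * ∫ y in closedBall (0 : E) R, u y ^ p) := by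
          field_simp
      _ ≤ (V + 1) * δ := by linarith

lemma mul_le_mul_rpow_add {q t w a : ℝ} (ht : 0 ≤ t) (hw1 : w ≤ 1) (ha : 1 ≤ a)
    (hp : p ≤ 1) (hpq : 2 ≤ p + q) :
    t * w ≤ a * t ^ p + a⁻¹ * (t ^ q * w ^ 2) := by
  have ha0 : 0 < a := by linarith
  rcases ht.eq_or_lt with rfl | ht0
  · have : 0 ≤ a * (0 : ℝ) ^ p + a⁻¹ * ((0 : ℝ) ^ q * w ^ 2) := by positivity
    simpa using this
  have hP : 0 < t ^ p := Real.rpow_pos_of_pos ht0 p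
  have hQ : 0 < t ^ q := Real.rpow_pos_of_pos ht0 q
  rcases le_or_gt t 1 with h | h
  · have h1 : t ≤ t ^ p := by
      simpa using Real.rpow_le_rpow_of_exponent_ge ht0 h hp
    have h2 : 0 ≤ a⁻¹ * (t ^ q * w ^ 2) := by positivity
    nlinarith
  · have h1 : t ^ 2 ≤ t ^ p * t ^ q := by
      rw [← Real.rpow_add ht0, ← Real.rpow_natCast t 2]
      exact Real.rpow_le_rpow_of_exponent_le h.le (by simpa using hpq)
    have h2 : (t * w) ^ 2 ≤ (a * t ^ p + a⁻¹ * (t ^ q * w ^ 2)) ^ 2 := by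
      have h3 : a * t ^ p * (a⁻¹ * (t ^ q * w ^ 2)) = t ^ p * t ^ q * w ^ 2 := by
        field_simp
      have h4 : t ^ 2 * w ^ 2 ≤ t ^ p * t ^ q * w ^ 2 := by gcongr
      have h5 : 0 ≤ a * t ^ p := by positivity
      have h6 : 0 ≤ a⁻¹ * (t ^ q * w ^ 2) := by positivity
      nlinarith
    exact le_of_sq_le_sq h2 (by positivity)

end Convolution

section TestFunction

variable {N : ℕ} {Ψ : ℝ → ℝ} {p q : ℝ} {u : EuclideanSpace ℝ (Fin N) → ℝ}

local notation "E" => EuclideanSpace ℝ (Fin N)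

lemma exists_scaled_cutoff (m : ℕ) : ∃ C > 0, ∀ R : ℝ, 1 ≤ R → ∃ w : E → ℝ,
    ContDiff ℝ ∞ w ∧ (∀ x, 0 ≤ w x) ∧ (∀ x, w x ≤ 1) ∧ (∀ x, ‖x‖ ≤ R / 2 → w x = 1) ∧
      (∀ x, R < ‖x‖ → w x = 0) ∧ ∀ x, negLapPow m (fun y => w y ^ 2) x ≤ C * w x := by
  obtain ⟨w, hw, hw0, hw1, hin, hout, C, hC, hlap⟩ := exists_cutoff (N := N) m
  refine ⟨C, hC, fun R hR => ⟨fun x => w (R⁻¹ • (x - 0)), ?_, fun x => hw0 _, fun x => hw1 _,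
    fun x hx => hin _ ?_, fun x hx => hout _ ?_, fun x => ?_⟩⟩
  · exact hw.comp ((contDiff_id.sub contDiff_const).const_smul _)
  · have hR0 : 0 < R := by linarith
    rw [sub_zero, norm_smul, Real.norm_of_nonneg (by positivity), inv_mul_le_iff₀ hR0]
    linarith
  · have hR0 : 0 < R := by linarith
    rw [sub_zero, norm_smul, Real.norm_of_nonneg (by positivity), lt_inv_mul_iff₀ hR0]
    linarith
  · have h := negLapPow_comp_dilation m (hw.pow 2) R⁻¹ (0 : E)
    rw [h]
    have h1 : R⁻¹ ^ (2 * m) ≤ 1 := pow_le_one₀ (by positivity) (inv_le_one_of_one_le₀ hR)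
    have h2 : 0 ≤ R⁻¹ ^ (2 * m) := by positivity
    calc R⁻¹ ^ (2 * m) * negLapPow m (fun y => w y ^ 2) (R⁻¹ • (x - 0))
        ≤ R⁻¹ ^ (2 * m) * (C * w (R⁻¹ • (x - 0))) := by gcongr; exact hlap _
      _ ≤ 1 * (C * w (R⁻¹ • (x - 0))) := by
          gcongr
          exact mul_nonneg hC.le (hw0 _)
      _ = _ := one_mul _

lemma integral_mul_integral_le_of_cutoff {m : ℕ} {R C K : ℝ} {w : E → ℝ}
    (hreg : ContDiff ℝ (2 * m) u) (hpos : ∀ x, 0 ≤ u x) (hq : 0 < q)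
    (hw : ContDiff ℝ ∞ w) (hout : ∀ x, R < ‖x‖ → w x = 0)
    (hlap : ∀ x, negLapPow m (fun y => w y ^ 2) x ≤ C * w x)
    (hf : ∀ x, ‖x‖ ≤ R → K * u x ^ q ≤ negLapPow m u x) :
    K * ∫ x, u x ^ q * w x ^ 2 ≤ C * ∫ x, u x * w x := by
  have hu : Continuous u := hreg.continuous
  have huq : Continuous (fun y => u y ^ q) := hu.rpow_const fun _ => Or.inr hq.le
  have hs : HasCompactSupport w :=
    HasCompactSupport.intro (isCompact_closedBall (0 : E) R) fun x hx => hout x (by simpa using hx)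
  have hs2 : HasCompactSupport (fun y => w y ^ 2) :=
    HasCompactSupport.intro (isCompact_closedBall (0 : E) R) fun x hx => by
      simp [hout x (by simpa using hx)]
  have hcl : Continuous (negLapPow m fun y => w y ^ 2) :=
    (contDiff_negLapPow m (hw.pow 2)).continuous
  have hcf : Continuous (negLapPow m u) := continuous_negLapPow m hreg
  have hcw2 : Continuous (fun y => w y ^ 2) := hw.continuous.pow 2
  calc K * ∫ x, u x ^ q * w x ^ 2 = ∫ x, K * (u x ^ q * w x ^ 2) := (integral_const_mul _ _).symm
    _ ≤ ∫ x, negLapPow m u x * w x ^ 2 := by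
        refine integral_mono ?_ ?_ fun x => ?_
        · exact ((huq.mul hcw2).integrable_of_hasCompactSupport hs2.mul_left).const_mul _
        · exact (hcf.mul hcw2).integrable_of_hasCompactSupport hs2.mul_left
        · rcases le_or_gt ‖x‖ R with h | h
          · have := mul_le_mul_of_nonneg_right (hf x h) (sq_nonneg (w x))
            simpa only [mul_assoc] using this
          · simp [hout x h]
    _ = ∫ x, u x * negLapPow m (fun y => w y ^ 2) x :=
        integral_negLapPow_mul m hreg (hw.pow 2) hs2
    _ ≤ ∫ x, C * (u x * w x) := by
        refine integral_mono ?_ ?_ fun x => ?_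
        · exact (hu.mul hcl).integrable_of_hasCompactSupport (hs2.negLapPow m).mul_left
        · exact ((hu.mul hw.continuous).integrable_of_hasCompactSupport hs.mul_left).const_mul _
        · have := mul_le_mul_of_nonneg_left (hlap x) (hpos x)
          calc _ ≤ _ := this
            _ = _ := by ring
    _ = C * ∫ x, u x * w x := integral_const_mul _ _

lemma integral_mul_cutoff_le {R a : ℝ} {w : E → ℝ} (hu : Continuous u) (hpos : ∀ x, 0 ≤ u x)
    (hp0 : 0 < p) (hp : p ≤ 1) (hq : 0 < q) (hpq : 2 ≤ p + q) (hw : Continuous w)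
    (hw1 : ∀ x, w x ≤ 1) (hout : ∀ x, R < ‖x‖ → w x = 0) (ha : 1 ≤ a) :
    ∫ x, u x * w x ≤
      a * (∫ x in closedBall (0 : E) R, u x ^ p) + a⁻¹ * ∫ x, u x ^ q * w x ^ 2 := by
  have hup : Continuous (fun y => u y ^ p) := hu.rpow_const fun _ => Or.inr hp0.le
  have huq : Continuous (fun y => u y ^ q) := hu.rpow_const fun _ => Or.inr hq.le
  have hs : HasCompactSupport w :=
    HasCompactSupport.intro (isCompact_closedBall (0 : E) R) fun x hx => hout x (by simpa using hx)
  have hs2 : HasCompactSupport (fun y => w y ^ 2) :=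
    HasCompactSupport.intro (isCompact_closedBall (0 : E) R) fun x hx => by
      simp [hout x (by simpa using hx)]
  have h1 : Integrable (fun x => u x * w x) :=
    (hu.mul hw).integrable_of_hasCompactSupport hs.mul_left
  have h2 : Integrable (fun x => u x ^ q * w x ^ 2) :=
    (huq.mul (hw.pow 2)).integrable_of_hasCompactSupport hs2.mul_left
  have h3 : Integrable ((closedBall (0 : E) R).indicator fun x => u x ^ p) :=
    (integrable_indicator_iff measurableSet_closedBall).2
      (hup.continuousOn.integrableOn_compact (isCompact_closedBall 0 R))
  rw [← integral_indicator measurableSet_closedBall, ← integral_const_mul, ← integral_const_mul,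
    ← integral_add (h3.const_mul _) (h2.const_mul _)]
  refine integral_mono h1 ((h3.const_mul _).add (h2.const_mul _)) fun x => ?_
  change u x * w x ≤
    a * (closedBall (0 : E) R).indicator (fun x => u x ^ p) x + a⁻¹ * (u x ^ q * w x ^ 2)
  rcases le_or_gt ‖x‖ R with h | h
  · rw [Set.indicator_of_mem (by simpa using h)]
    exact mul_le_mul_rpow_add (hpos x) (hw1 x) ha hp hpq
  · rw [Set.indicator_of_notMem (by simpa using h)]
    simp [hout x h]

lemma setIntegral_rpow_pos (hp : 0 < p) (hu : Continuous u) (hpos : ∀ x, 0 ≤ u x) {x₀ : E}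
    (hx₀ : 0 < u x₀) {R : ℝ} (hR : ‖x₀‖ < R) : 0 < ∫ y in closedBall (0 : E) R, u y ^ p := by
  have hup : Continuous (fun y => u y ^ p) := hu.rpow_const fun _ => Or.inr hp.le
  rw [setIntegral_pos_iff_support_of_nonneg_ae
    (Eventually.of_forall fun y => Real.rpow_nonneg (hpos y) p)
    (hup.continuousOn.integrableOn_compact (isCompact_closedBall 0 R))]
  have hopen : IsOpen ({y : E | 0 < u y} ∩ ball 0 R) :=
    (isOpen_lt continuous_const hu).inter isOpen_ball
  refine (hopen.measure_pos volume ⟨x₀, hx₀, by simpa using hR⟩).trans_le (measure_mono ?_)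
  exact fun y hy => ⟨(Real.rpow_pos_of_pos hy.1 p).ne', ball_subset_closedBall hy.2⟩

lemma tendsto_mean_of_le_one {m : ℕ} (hN : 0 < N) (hK : CondK N Ψ) (hp0 : 0 < p) (hp : p ≤ 1)
    (hq : 0 < q) (hpq : 2 ≤ p + q) (hreg : ContDiff ℝ (2 * m) u) (hpos : ∀ x, 0 ≤ u x)
    (hint : IntegrableOn (fun y : E => u y ^ p * Ψ (‖y‖ / 2)) {y : E | 1 < ‖y‖})
    (hineq : ∀ x : E, (∫ y : E, u y ^ p * Ψ ‖y - x‖) * u x ^ q ≤ negLapPow m u x) {x₀ : E}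
    (hx₀ : 0 < u x₀) :
    Tendsto (fun R : ℝ => (R ^ N)⁻¹ * ∫ y in closedBall (0 : E) R, u y) atTop (𝓝 0) := by
  have hu : Continuous u := hreg.continuous
  obtain ⟨C, hC, hcut⟩ := exists_scaled_cutoff (N := N) m
  refine tendsto_zero_of_eventually_le_mul (C := 2 * 2 ^ N) (by positivity) ?_ fun δ hδ => ?_
  · filter_upwards [eventually_ge_atTop 0] with R hR
    have : 0 ≤ ∫ y in closedBall (0 : E) R, u y := integral_nonneg hpos
    positivity
  have hdouble : Tendsto (fun R : ℝ => 2 * R) atTop atTop :=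
    tendsto_id.const_mul_atTop (by norm_num)
  suffices ∀ᶠ R : ℝ in atTop, ∫ y in closedBall (0 : E) (R / 2), u y ≤ 2 * δ * R ^ N by
    filter_upwards [hdouble.eventually this, eventually_gt_atTop 0] with R hR hR0
    rw [mul_div_cancel_left₀ _ (by norm_num : (2 : ℝ) ≠ 0)] at hR
    rw [inv_mul_le_iff₀ (by positivity)]
    calc _ ≤ _ := hR
      _ = _ := by rw [mul_pow]; ring
  have hP := (tendsto_mean_rpow hN hK hp0 hu hpos hint).eventually_le_const hδ
  have hΨ := (hK.tendsto.comp hdouble).eventually_ge_atTop (2 * 2 ^ N * C / δ)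
  filter_upwards [hP, hΨ, eventually_ge_atTop 1, eventually_gt_atTop ‖x₀‖] with R hP hΨ hR1 hRx
  have hR0 : 0 < R := by linarith
  obtain ⟨w, hw, hw0, hw1, hin, hout, hlap⟩ := hcut R hR1
  set P := ∫ y in closedBall (0 : E) R, u y ^ p with hPdef
  have hP0 : 0 < P := setIntegral_rpow_pos hp0 hu hpos hx₀ hRx
  have hΨ0 : 0 < Ψ (2 * R) := hK.pos _ (by linarith)
  set I := ∫ x, u x * w x with hI
  set Q := ∫ x, u x ^ q * w x ^ 2 with hQ
  have hI0 : 0 ≤ I := integral_nonneg fun x => mul_nonneg (hpos x) (hw0 x)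
  have h1 : Ψ (2 * R) * P * Q ≤ C * I :=
    integral_mul_integral_le_of_cutoff hreg hpos hq hw hout hlap fun x hx =>
      (mul_le_mul_of_nonneg_right (kernel_mul_integral_le hN hK hp0 hu hpos hint hx)
        (Real.rpow_nonneg (hpos x) q)).trans (hineq x)
  have hRN : 0 < R ^ N := by positivity
  rw [inv_mul_le_iff₀ hRN] at hP
  have h2 : I ≤ δ * R ^ N / P * P + (δ * R ^ N / P)⁻¹ * Q :=
    integral_mul_cutoff_le hu hpos hp0 hp hq hpq hw.continuous hw1 hout
      ((one_le_div hP0).2 (by linarith))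
  have h3 : 2 * C ≤ δ * (R ^ N * Ψ (2 * R)) := by
    have h4 : 2 * 2 ^ N * C / δ ≤ (2 * R) ^ N * Ψ (2 * R) := hΨ
    rw [div_le_iff₀ hδ, mul_pow] at h4
    have h5 : (0 : ℝ) < 2 ^ N := by positivity
    refine le_of_mul_le_mul_left ?_ h5
    linarith
  have h4 : (δ * R ^ N / P)⁻¹ * Q ≤ I / 2 := by
    rw [inv_div, div_mul_eq_mul_div, div_le_iff₀ (by positivity)]
    refine le_of_mul_le_mul_left ?_ hΨ0
    have h5 := mul_le_mul_of_nonneg_right h3 hI0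
    linarith
  rw [div_mul_cancel₀ _ hP0.ne'] at h2
  have h5 : ∫ y in closedBall (0 : E) (R / 2), u y ≤ I := by
    have hs : HasCompactSupport w :=
      HasCompactSupport.intro (isCompact_closedBall (0 : E) R)
        fun x hx => hout x (by simpa using hx)
    have hi : Integrable (fun x => u x * w x) :=
      (hu.mul hw.continuous).integrable_of_hasCompactSupport hs.mul_left
    calc ∫ y in closedBall (0 : E) (R / 2), u y = ∫ y in closedBall (0 : E) (R / 2), u y * w y :=
          setIntegral_congr_fun measurableSet_closedBall fun y hy => by
            simp only [hin y (by simpa using hy), mul_one]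
      _ ≤ I := setIntegral_le_integral hi
          (Eventually.of_forall fun x => mul_nonneg (hpos x) (hw0 x))
  linarith

lemma lintegral_rpow_mul_kernel_lt_top (hK : CondK N Ψ) (hp : 0 < p)
    (hpos : ∀ x, 0 ≤ u x)
    (hint : IntegrableOn (fun y : E => u y ^ p * Ψ (‖y‖ / 2)) {y : E | 1 < ‖y‖}) {c R s : ℝ}
    (hc : 0 < c) (hs : 0 ≤ s) (hlow : ∀ x : E, R ≤ ‖x‖ → c * ‖x‖ ^ (-s) ≤ u x) :
    ∫⁻ y in {y : E | 1 < ‖y‖}, ENNReal.ofReal (‖y‖ ^ (-(p * s)) * Ψ ‖y‖) < ⊤ := by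
  have hmS : MeasurableSet {y : E | 1 < ‖y‖} :=
    (isOpen_lt continuous_const continuous_norm).measurableSet
  have hball : Integrable ((closedBall (0 : E) R).indicator fun _ => Ψ 1) :=
    (integrable_indicator_iff measurableSet_closedBall).2
      (integrableOn_const measure_closedBall_lt_top.ne)
  have hG := hball.integrableOn (s := {y : E | 1 < ‖y‖}) |>.add (hint.const_mul (c ^ p)⁻¹)
  refine (setLIntegral_mono' hmS fun y hy => ENNReal.ofReal_le_ofReal ?_).trans_lt
    hG.lintegral_lt_top
  have hy1 : 1 < ‖y‖ := hy
  have hy0 : 0 < ‖y‖ := by linarith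
  have hcp : 0 < c ^ p := Real.rpow_pos_of_pos hc p
  have hΨ1 := hK.pos 1 one_pos
  have hΨy := hK.pos _ hy0
  have hΨy2 := hK.pos (‖y‖ / 2) (by linarith)
  change ‖y‖ ^ (-(p * s)) * Ψ ‖y‖ ≤
    (closedBall (0 : E) R).indicator (fun _ => Ψ 1) y + (c ^ p)⁻¹ * (u y ^ p * Ψ (‖y‖ / 2))
  rcases lt_or_ge ‖y‖ R with h | h
  · have h1 : ‖y‖ ^ (-(p * s)) ≤ 1 :=
      Real.rpow_le_one_of_one_le_of_nonpos hy1.le (neg_nonpos.2 (by positivity))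
    have h2 : Ψ ‖y‖ ≤ Ψ 1 := hK.anti (Set.mem_Ioi.2 one_pos) hy0 hy1.le
    have h3 : ‖y‖ ^ (-(p * s)) * Ψ ‖y‖ ≤ 1 * Ψ 1 := mul_le_mul h1 h2 hΨy.le zero_le_one
    have h4 : 0 ≤ (c ^ p)⁻¹ * (u y ^ p * Ψ (‖y‖ / 2)) :=
      mul_nonneg (by positivity) (mul_nonneg (Real.rpow_nonneg (hpos y) p) hΨy2.le)
    rw [Set.indicator_of_mem (by simpa using h.le)]
    linarith
  · have h0 : 0 ≤ (closedBall (0 : E) R).indicator (fun _ => Ψ 1) y :=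
      Set.indicator_nonneg (fun _ _ => hΨ1.le) _
    have h1 : c ^ p * ‖y‖ ^ (-(p * s)) ≤ u y ^ p := by
      have h2 := Real.rpow_le_rpow (by positivity) (hlow y h) hp.le
      rwa [Real.mul_rpow hc.le (by positivity), ← Real.rpow_mul hy0.le,
        show -s * p = -(p * s) by ring] at h2
    have h2 : ‖y‖ ^ (-(p * s)) ≤ (c ^ p)⁻¹ * u y ^ p := by
      rwa [le_inv_mul_iff₀ hcp]
    have h3 : Ψ ‖y‖ ≤ Ψ (‖y‖ / 2) := hK.anti (Set.mem_Ioi.2 (by linarith)) hy0 (by linarith)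
    have h4 : ‖y‖ ^ (-(p * s)) * Ψ ‖y‖ ≤ (c ^ p)⁻¹ * u y ^ p * Ψ (‖y‖ / 2) :=
      mul_le_mul h2 h3 hΨy.le ((by positivity : 0 ≤ ‖y‖ ^ (-(p * s))).trans h2)
    linarith

end TestFunction

theorem stmt_4 (N m : ℕ) (hm : 1 ≤ m) (hN : 2 * m < N)
    (Ψ : ℝ → ℝ) (hK : CondK N Ψ)
    (p q : ℝ) (hp : 0 < p) (hq : 0 < q) (hcond : 1 ≤ p ∨ 2 ≤ p + q)
    (hdiv : ∫⁻ y in {y : EuclideanSpace ℝ (Fin N) | 1 < ‖y‖},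
      ENNReal.ofReal (‖y‖ ^ (-(p * ((N : ℝ) - 2 * m))) * Ψ ‖y‖) = ⊤)
    (u : EuclideanSpace ℝ (Fin N) → ℝ)
    (hreg : ContDiff ℝ (2 * m) u)
    (hpos : ∀ x, 0 ≤ u x)
    (hint : IntegrableOn (fun y : EuclideanSpace ℝ (Fin N) => u y ^ p * Ψ (‖y‖ / 2))
      {y : EuclideanSpace ℝ (Fin N) | 1 < ‖y‖})
    (hineq : ∀ x : EuclideanSpace ℝ (Fin N),
      (∫ y : EuclideanSpace ℝ (Fin N), u y ^ p * Ψ ‖y - x‖) * u x ^ q ≤ negLapPow m u x) :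
    ∀ x, u x = 0 := by
  by_contra! hne
  obtain ⟨x₀, hx₀⟩ := hne
  have hx₀ : 0 < u x₀ := (hpos x₀).lt_of_ne' hx₀
  have hN0 : 0 < N := by omega
  have hu : Continuous u := hreg.continuous
  have hmain : ∀ x R, ‖x‖ ≤ R →
      Ψ (2 * R) * (∫ y in closedBall 0 R, u y ^ p) * u x ^ q ≤ negLapPow m u x := fun x R hx =>
    (mul_le_mul_of_nonneg_right (kernel_mul_integral_le hN0 hK hp hu hpos hint hx)
      (Real.rpow_nonneg (hpos x) q)).trans (hineq x)
  have hP : ∀ R, ‖x₀‖ < R → 0 < ∫ y in closedBall 0 R, u y ^ p := fun R hR =>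
    setIntegral_rpow_pos hp hu hpos hx₀ hR
  have hf : ∀ x, 0 ≤ negLapPow m u x := by
    intro x
    refine le_trans ?_ (hmain x (‖x‖ + ‖x₀‖ + 1) (by linarith [norm_nonneg x₀]))
    have h1 := hP (‖x‖ + ‖x₀‖ + 1) (by linarith [norm_nonneg x])
    have h2 := hK.pos (2 * (‖x‖ + ‖x₀‖ + 1)) (by positivity)
    exact mul_nonneg (mul_pos h2 h1).le (Real.rpow_nonneg (hpos x) q)
  have hf₀ : 0 < negLapPow m u x₀ := by
    refine lt_of_lt_of_le ?_ (hmain x₀ (‖x₀‖ + 1) (by linarith))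
    have h1 := hP (‖x₀‖ + 1) (by linarith)
    have h2 := hK.pos (2 * (‖x₀‖ + 1)) (by positivity)
    exact mul_pos (mul_pos h2 h1) (Real.rpow_pos_of_pos hx₀ q)
  have hmean : Tendsto (fun R : ℝ =>
      (R ^ N)⁻¹ * ∫ y in closedBall (0 : EuclideanSpace ℝ (Fin N)) R, u y) atTop (𝓝 0) := by
    rcases le_or_gt 1 p with h | h
    · exact tendsto_mean_of_one_le h hu hpos (tendsto_mean_rpow hN0 hK hp hu hpos hint)
    · exact tendsto_mean_of_le_one hN0 hK hp h.le hq (hcond.resolve_left h.not_ge) hreg hpos hint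
        hineq hx₀
  obtain ⟨c, hc, R₀, -, hlow⟩ := exists_lower_bound hm hN hreg hpos hf hf₀ hmean
  have hs : (0 : ℝ) ≤ (N : ℝ) - 2 * m := by
    have : ((2 * m : ℕ) : ℝ) < N := by exact_mod_cast hN
    push_cast at this
    linarith
  exact (lintegral_rpow_mul_kernel_lt_top hK hp hpos hint hc hs hlow).ne hdiv
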